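/- No pushdown compressor is universal for finite-state compressors: for every information-lossless pushdown compressor C over the binary alphabet working with an endmarker, there exist an information-lossless finite-state compressor C' and an infinite binary sequence S (namely S = 0^∞) such that R_{C'}(S) < ρ_C(S). -/

import Mathlib

/-- A pushdown transducer with input alphabet `In`, output alphabet `Out`,
stack alphabet `Γ` and state set `Q`.  A transition `δ q none z` is a
`λ`-rule (no input symbol is read); `det` is the determinism requirement that
for every state and top stack symbol, either the `λ`-rule or all the reading
rules are undefined; `bottom` requires that the bottom-of-stack symbol `z₀`
is never removed from the bottom of the stack. -/
structure PDT (In Out Γ Q : Type*) where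
  δ : Q → Option In → Γ → Option (Q × List Γ)
  ν : Q → Option In → Γ → List Out
  q₀ : Q
  z₀ : Γ
  det : ∀ q z, δ q none z = none ∨ ∀ b, δ q (some b) z = none
  bottom : ∀ q b p, δ q b z₀ = some p → ∃ q' v, p = (q', v ++ [z₀])

namespace PDT

variable {In Out Γ Q : Type*}

/-- Instantaneous description: current state, stack (top first), remaining
input, and output produced so far. -/
abbrev ID (In Out Γ Q : Type*) := Q × List Γ × List In × List Out

/-- One computation step of a pushdown transducer: either a `λ`-rule, or the
reading of one input symbol; in both cases the top stack symbol is replaced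
by a (possibly empty) word and the corresponding output is appended. -/
inductive Step (M : PDT In Out Γ Q) : ID In Out Γ Q → ID In Out Γ Q → Prop
  | lam {q z s inp out q' v} : M.δ q none z = some (q', v) →
      Step M (q, z :: s, inp, out) (q', v ++ s, inp, out ++ M.ν q none z)
  | read {q z s b inp out q' v} : M.δ q (some b) z = some (q', v) →
      Step M (q, z :: s, b :: inp, out) (q', v ++ s, inp, out ++ M.ν q (some b) z)

/-- An ID is terminal when the input has been entirely read and no `λ`-rule
is enabled. -/
def Terminal (M : PDT In Out Γ Q) : ID In Out Γ Q → Prop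
  | (q, s, inp, _) => inp = [] ∧ ∀ z s', s = z :: s' → M.δ q none z = none

/-- `M.Computes w qf o`: the complete run of `M` on input `w` ends in state
`qf` having produced the total output `o`. -/
def Computes (M : PDT In Out Γ Q) (w : List In) (qf : Q) (o : List Out) : Prop :=
  ∃ s, Relation.ReflTransGen (Step M) (M.q₀, [M.z₀], w, []) (qf, s, [], o) ∧
    Terminal M (qf, s, [], o)

end PDT

/-- A pushdown compressor (working without endmarker) over the alphabet `A`:
a pushdown transducer with input and output alphabet `A` whose computation
terminates on every input, hence computing a total function. -/
structure PDC (A Γ Q : Type*) extends PDT A A Γ Q where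
  total : ∀ w : List A, ∃ qf o, toPDT.Computes w qf o

namespace PDC
variable {A Γ Q : Type*}

/-- The state `δ_Q(w)` reached by the compressor after processing `w`. -/
noncomputable def finalState (M : PDC A Γ Q) (w : List A) : Q := (M.total w).choose

/-- `M.output w` is `C(w)`, the output of the compressor on input `w`. -/
noncomputable def output (M : PDC A Γ Q) (w : List A) : List A :=
  (M.total w).choose_spec.choose

/-- Information-losslessness: the map `w ↦ (C(w), δ_Q(w))` is injective. -/
def IL (M : PDC A Γ Q) : Prop :=
  Function.Injective fun w => (M.output w, M.finalState w)


end PDC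

/-- The input word followed by the endmarker `#` (modelled as `none`). -/
def endmark {A : Type*} (w : List A) : List (Option A) := w.map some ++ [none]

/-- A pushdown compressor working with an endmarker, over the alphabet `A`:
a pushdown transducer whose input alphabet is `Option A`, where `none` plays
the role of the endmarker `#` (so that `λ`-rules may keep popping the stack
and producing output after the endmarker has been read), and whose
computation on `w#` terminates for every word `w`. -/
structure PDCE (A Γ Q : Type*) extends PDT (Option A) A Γ Q where
  total : ∀ w : List A, ∃ qf o, toPDT.Computes (endmark w) qf o

namespace PDCE
variable {A Γ Q : Type*}

/-- The final state reached by the compressor on input `w#`. -/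
noncomputable def finalState (M : PDCE A Γ Q) (w : List A) : Q := (M.total w).choose

/-- `M.output w` is `C(w#)`, the total output of the compressor on `w#`. -/
noncomputable def output (M : PDCE A Γ Q) (w : List A) : List A :=
  (M.total w).choose_spec.choose

/-- Information-losslessness: the map `w ↦ (C(w#), final state)` is injective. -/
def IL (M : PDCE A Γ Q) : Prop :=
  Function.Injective fun w => (M.output w, M.finalState w)

end PDCE

/-- A finite-state compressor (finite-state transducer) over the alphabet `A`. -/
structure FSC (A Q : Type*) where
  δ : Q → A → Q
  ν : Q → A → List A
  q₀ : Q

namespace FSC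
variable {A Q : Type*}

/-- The output of the transducer started in state `q`. -/
def outAux (M : FSC A Q) : Q → List A → List A
  | _, [] => []
  | q, b :: w => M.ν q b ++ M.outAux (M.δ q b) w

/-- `M.output w` is `C'(w)`, the concatenated output of the transducer on `w`. -/
def output (M : FSC A Q) (w : List A) : List A := M.outAux M.q₀ w

/-- The state reached by the transducer after reading `w`. -/
def finalState (M : FSC A Q) (w : List A) : Q := w.foldl M.δ M.q₀

/-- Information-losslessness: the map `w ↦ (C'(w), final state)` is injective. -/
def IL (M : FSC A Q) : Prop :=
  Function.Injective fun w => (M.output w, M.finalState w)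

end FSC

/-- A rewriting system acting on the top of a stack: in state `p` with top symbol `z`, the
value `some (p', v, w)` moves to state `p'`, replaces `z` by the word `v` and emits `w`. -/
abbrev TopRewriting (P Γ β : Type*) := P → Γ → Option (P × List Γ × List β)

namespace TopRewriting

variable {P Γ β : Type*}

/-- `Run G p s w p' s'`: `G` leads from state `p` and stack `s` to state `p'` and stack `s'`,
emitting `w`. -/
inductive Run (G : TopRewriting P Γ β) : P → List Γ → List β → P → List Γ → Prop
  | refl (p : P) (s : List Γ) : Run G p s [] p s
  | head {p p' p'' : P} {z : Γ} {v s s'' : List Γ} {w w' : List β} :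
      G p z = some (p', v, w) → Run G p' (v ++ s) w' p'' s'' →
      Run G p (z :: s) (w ++ w') p'' s''

/-- No rule applies to the state `p` with stack `s`. -/
def Stuck (G : TopRewriting P Γ β) (p : P) (s : List Γ) : Prop :=
  ∀ z r, s = z :: r → G p z = none

/-- From state `p` and stack `s`, `G` halts in state `pf` having emitted `w`. -/
def Halts (G : TopRewriting P Γ β) (p : P) (s : List Γ) (w : List β) (pf : P) : Prop :=
  ∃ s', Run G p s w pf s' ∧ Stuck G pf s'

variable {G : TopRewriting P Γ β}

theorem stuck_nil (p : P) : Stuck G p [] := by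
  intro z r h
  cases h

theorem Run.append_stack {p p' : P} {s s' : List Γ} {w : List β} (h : Run G p s w p' s')
    (r : List Γ) : Run G p (s ++ r) w p' (s' ++ r) := by
  induction h with
  | refl p s => exact Run.refl _ _
  | head hG _ ih =>
    rw [List.append_assoc] at ih
    exact Run.head hG ih

theorem Run.trans {p p' p'' : P} {s s' s'' : List Γ} {w w' : List β} (h : Run G p s w p' s')
    (h' : Run G p' s' w' p'' s'') : Run G p s (w ++ w') p'' s'' := by
  induction h with
  | refl p s => exact h'
  | head hG _ ih =>
    rw [List.append_assoc]
    exact Run.head hG (ih h')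

theorem Run.halts {p p' : P} {s : List Γ} {w : List β} (h : Run G p s w p' []) :
    Halts G p s w p' :=
  ⟨[], h, stuck_nil _⟩

theorem Halts.of_run {p p' pf : P} {s s' : List Γ} {w w' : List β} (h : Run G p s w p' s') :
    Halts G p s w' pf → ∃ w₂, w' = w ++ w₂ ∧ Halts G p' s' w₂ pf := by
  induction h generalizing w' with
  | refl p s => exact fun h => ⟨w', rfl, h⟩
  | head hG _ ih =>
    rintro ⟨t, hr, hst⟩
    cases hr with
    | refl => simp [hst _ _ rfl] at hG
    | head hG' hr' =>
      rw [hG] at hG'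
      cases hG'
      obtain ⟨w₂, rfl, h₂⟩ := ih ⟨t, hr', hst⟩
      exact ⟨w₂, by simp, h₂⟩

theorem Halts.unique {p pf pf' : P} {s : List Γ} {w w' : List β} (h : Halts G p s w pf)
    (h' : Halts G p s w' pf') : w' = w ∧ pf' = pf := by
  obtain ⟨t, ht, hst⟩ := h
  obtain ⟨w₂, rfl, t₂, hr, -⟩ := h'.of_run ht
  cases hr with
  | refl => simp
  | head hG _ => simp [hst _ _ rfl] at hG

theorem Run.pop_or_keep {p pf : P} {y s' : List Γ} {w : List β} (h : Run G p y w pf s') :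
    ∀ x s, y = x ++ s → (∃ w₁ p₁ w₂, Run G p x w₁ p₁ [] ∧ Run G p₁ s w₂ pf s' ∧ w = w₁ ++ w₂) ∨
      ∃ x', x' ≠ [] ∧ Run G p x w pf x' ∧ s' = x' ++ s := by
  induction h with
  | refl p y =>
    rintro x s rfl
    rcases eq_or_ne x [] with rfl | hx
    · exact .inl ⟨[], p, [], .refl _ _, .refl _ _, rfl⟩
    · exact .inr ⟨x, hx, .refl _ _, rfl⟩
  | @head p p' p'' z v r s'' w w' hG hr ih =>
    intro x s hxs
    cases x with
    | nil =>
      refine .inl ⟨[], p, _, .refl _ _, ?_, rfl⟩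
      rw [List.nil_append] at hxs
      exact hxs ▸ Run.head hG hr
    | cons a x =>
      obtain ⟨rfl, rfl⟩ : z = a ∧ r = x ++ s := by simpa using hxs
      rcases ih (v ++ x) s (by simp) with ⟨w₁, p₁, w₂, h₁, h₂, rfl⟩ | ⟨x', hx', h₁, h₂⟩
      · exact .inl ⟨w ++ w₁, p₁, w₂, .head hG h₁, h₂, by simp⟩
      · exact .inr ⟨x', hx', .head hG h₁, h₂⟩

/-- A halting computation on `x ++ s` either pops `x` entirely, or never looks below `x`. -/
theorem Halts.pop_or_keep {p pf : P} {x s : List Γ} {w : List β} (h : Halts G p (x ++ s) w pf) :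
    (∃ w₁ p₁ w₂, Run G p x w₁ p₁ [] ∧ Halts G p₁ s w₂ pf ∧ w = w₁ ++ w₂) ∨
      ∀ r, Halts G p (x ++ r) w pf := by
  obtain ⟨s', hr, hst⟩ := h
  rcases hr.pop_or_keep x s rfl with ⟨w₁, p₁, w₂, h₁, h₂, rfl⟩ | ⟨x', hx', h₁, rfl⟩
  · exact .inl ⟨w₁, p₁, w₂, h₁, ⟨s', h₂, hst⟩, rfl⟩
  · refine .inr fun r => ⟨x' ++ r, h₁.append_stack r, ?_⟩
    obtain ⟨a, x'', rfl⟩ := List.exists_cons_of_ne_nil hx'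
    intro z t hzt
    obtain ⟨rfl, -⟩ : a = z ∧ _ := by simpa using hzt
    exact hst a (x'' ++ s) rfl

theorem exists_halts_length_le [Finite P] (G : TopRewriting P Γ β) (s : List Γ) :
    ∃ B, ∀ p w pf, Halts G p s w pf → w.length ≤ B := by
  have h : ∀ p, ∃ B, ∀ w pf, Halts G p s w pf → w.length ≤ B := by
    intro p
    by_cases hp : ∃ w pf, Halts G p s w pf
    · obtain ⟨w, pf, hw⟩ := hp
      exact ⟨w.length, fun w' pf' h' => by rw [(hw.unique h').1]⟩
    · exact ⟨0, fun w pf hw => (hp ⟨w, pf, hw⟩).elim⟩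
  choose f hf using h
  obtain ⟨B, hB⟩ := (Set.finite_range f).bddAbove
  exact ⟨B, fun p w pf hw => (hf p w pf hw).trans (hB ⟨p, rfl⟩)⟩

/-- If `G` halts on every stack `x ++ uᵏ ++ s`, then either `uᵏ` can be popped for all `k`, one
copy of `u` after the other, or the outcome does not depend on `k` for `k` large. -/
theorem pop_chain_or_eventually_const {p : P} {x u s : List Γ} {W : ℕ → List β} {pf : ℕ → P}
    (h : ∀ k, Halts G p (x ++ (List.replicate k u).flatten ++ s) (W k) (pf k)) :
    (∃ (w : ℕ → List β) (q : ℕ → P) (e v : ℕ → List β),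
      (∀ k, Halts G (q k) u (e k) (q (k + 1))) ∧ (∀ k, w (k + 1) = w k ++ e k) ∧
      (∀ k, Halts G (q k) s (v k) (pf k)) ∧ ∀ k, W k = w k ++ v k) ∨
    ∃ K, ∀ k, K ≤ k → W k = W K ∧ pf k = pf K := by
  by_cases hA : ∀ k, ∃ w q, Run G p (x ++ (List.replicate k u).flatten) w q []
  · left
    choose w q hwq using hA
    have h₁ : ∀ k, ∃ e, Halts G (q k) u e (q (k + 1)) ∧ w (k + 1) = w k ++ e := by
      intro k
      have hk := (hwq (k + 1)).halts
      rw [List.replicate_succ', List.flatten_append, ← List.append_assoc] at hk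
      obtain ⟨e, he, hh⟩ := hk.of_run ((hwq k).append_stack _)
      exact ⟨e, by simpa using hh, he⟩
    have h₂ : ∀ k, ∃ v, Halts G (q k) s v (pf k) ∧ W k = w k ++ v := by
      intro k
      obtain ⟨v, hv, hh⟩ := (h k).of_run ((hwq k).append_stack _)
      exact ⟨v, by simpa using hh, hv⟩
    choose e he hwe using h₁
    choose v hv hWv using h₂
    exact ⟨w, q, e, v, he, hwe, hv, hWv⟩
  · right
    push Not at hA
    obtain ⟨K, hK⟩ := hA
    refine ⟨K, fun k hk => ?_⟩
    rcases (h K).pop_or_keep with ⟨w₁, p₁, w₂, h₁, -⟩ | hall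
    · exact (hK _ _ h₁).elim
    · obtain ⟨d, rfl⟩ := Nat.exists_eq_add_of_le hk
      have hk' := h (K + d)
      rw [List.replicate_add, List.flatten_append, ← List.append_assoc, List.append_assoc] at hk'
      exact (hall _).unique hk'

theorem exists_length_le_linear [Finite P] {p : P} {x u s : List Γ} {W : ℕ → List β} {pf : ℕ → P}
    (h : ∀ k, Halts G p (x ++ (List.replicate k u).flatten ++ s) (W k) (pf k)) :
    ∃ B, ∀ k, (W k).length ≤ B * (k + 1) := by
  rcases pop_chain_or_eventually_const h with ⟨w, q, e, v, he, hw, hv, hW⟩ | ⟨K, hK⟩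
  · obtain ⟨B₁, hB₁⟩ := exists_halts_length_le G u
    obtain ⟨B₂, hB₂⟩ := exists_halts_length_le G s
    have hwk : ∀ k, (w k).length ≤ (w 0).length + B₁ * k := by
      intro k
      induction k with
      | zero => simp
      | succ k ih =>
        have := hB₁ _ _ _ (he k)
        rw [hw, List.length_append, mul_add]
        omega
    refine ⟨(w 0).length + B₁ + B₂, fun k => ?_⟩
    have h₁ := hwk k
    have h₂ := hB₂ _ _ _ (hv k)
    rw [hW, List.length_append]
    nlinarith [Nat.zero_le (k * (w 0).length), Nat.zero_le (k * B₂)]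
  · refine ⟨∑ i ∈ Finset.range (K + 1), (W i).length, fun k => ?_⟩
    have hmin : W k = W (min k K) := by
      rcases le_total k K with hk | hk
      · rw [min_eq_left hk]
      · rw [min_eq_right hk, (hK k hk).1]
    have hle : (W (min k K)).length ≤ ∑ i ∈ Finset.range (K + 1), (W i).length :=
      Finset.single_le_sum (f := fun i => (W i).length) (fun _ _ => Nat.zero_le _)
        (Finset.mem_range.2 (by omega))
    rw [hmin]
    exact hle.trans (Nat.le_mul_of_pos_right _ (Nat.succ_pos k))

theorem div_card_le_length [Fintype P] {p : P} {x u s : List Γ} {W : ℕ → List β} {pf : ℕ → P}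
    (h : ∀ k, Halts G p (x ++ (List.replicate k u).flatten ++ s) (W k) (pf k))
    (hinj : Function.Injective fun k => (W k, pf k)) (k : ℕ) :
    k / Fintype.card P ≤ (W k).length := by
  rcases pop_chain_or_eventually_const h with ⟨w, q, e, v, he, hw, hv, hW⟩ | ⟨K, hK⟩
  · have hpre : ∀ a d, w a <+: w (a + d) := by
      intro a d
      induction d with
      | zero => exact List.prefix_rfl
      | succ d ih =>
        rw [← add_assoc, hw]
        exact ih.trans (List.prefix_append _ _)
    have hgrow : ∀ i, (w i).length + 1 ≤ (w (i + Fintype.card P)).length := by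
      intro i
      obtain ⟨a, b, hab, hq⟩ := Fintype.exists_ne_map_eq_of_card_lt
        (fun a : Fin (Fintype.card P + 1) => q (i + a)) (by simp)
      wlog hlt : a < b generalizing a b
      · exact this b a hab.symm hq.symm (lt_of_le_of_ne (not_lt.1 hlt) hab.symm)
      by_contra! hcon
      have hlt' : (a : ℕ) < b := hlt
      obtain ⟨d, hd⟩ := Nat.exists_eq_add_of_lt hlt'
      have hb : (b : ℕ) ≤ Fintype.card P := Nat.lt_succ_iff.1 b.2
      obtain ⟨d', hd'⟩ := Nat.exists_eq_add_of_le hb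
      have l₁ := (hpre i a).length_le
      have l₂ := (hpre (i + a) (d + 1))
      have l₃ := (hpre (i + b) d').length_le
      rw [show i + (a : ℕ) + (d + 1) = i + b by omega] at l₂
      rw [show i + (b : ℕ) + d' = i + Fintype.card P by omega] at l₃
      have hwab : w (i + a) = w (i + b) := l₂.eq_of_length (by
        have := l₂.length_le
        omega)
      have hva := hv (i + a)
      have hvb := hv (i + b)
      have hq' : q (i + a) = q (i + b) := hq
      rw [← hq'] at hvb
      obtain ⟨h₁, h₂⟩ := hva.unique hvb
      have := @hinj (i + a) (i + b) (by
        simp only [hW, hwab, h₁, h₂])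
      omega
    have hmul : ∀ m, m ≤ (w (m * Fintype.card P)).length := by
      intro m
      induction m with
      | zero => simp
      | succ m ih =>
        have := hgrow (m * Fintype.card P)
        rw [Nat.succ_mul]
        omega
    have hle := (hpre (k / Fintype.card P * Fintype.card P) (k % Fintype.card P)).length_le
    rw [Nat.div_add_mod'] at hle
    rw [hW, List.length_append]
    have := hmul (k / Fintype.card P)
    omega
  · have := @hinj (K + 1) K (by simp [hK (K + 1) (by omega)])
    omega

/-- One rewriting step, the identity on stuck configurations. -/
def step (G : TopRewriting P Γ β) : P × List Γ → P × List Γ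
  | (p, []) => (p, [])
  | (p, z :: s) =>
    match G p z with
    | some (p', v, _) => (p', v ++ s)
    | none => (p, z :: s)

/-- The word emitted by one rewriting step. -/
def emit (G : TopRewriting P Γ β) : P × List Γ → List β
  | (_, []) => []
  | (p, z :: _) =>
    match G p z with
    | some (_, _, w) => w
    | none => []

/-- The word emitted by the first `t` rewriting steps. -/
def trace (G : TopRewriting P Γ β) (c : P × List Γ) : ℕ → List β
  | 0 => []
  | t + 1 => trace G c t ++ emit G ((step G)^[t] c)

theorem trace_add (c : P × List Γ) (a b : ℕ) :
    trace G c (a + b) = trace G c a ++ trace G ((step G)^[a] c) b := by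
  induction b with
  | zero => simp [trace]
  | succ b ih =>
    rw [← add_assoc, trace, trace, ih, List.append_assoc, ← Function.iterate_add_apply,
      add_comm b a]

theorem run_step (c : P × List Γ) :
    Run G c.1 c.2 (emit G c) (step G c).1 (step G c).2 := by
  obtain ⟨p, _ | ⟨z, s⟩⟩ := c
  · exact Run.refl _ _
  · simp only [emit, step]
    split
    · rename_i p' v w hG
      simpa [hG] using Run.head hG (Run.refl p' (v ++ s))
    · rename_i hG
      simpa [hG] using Run.refl p (z :: s)

theorem run_iterate (c : P × List Γ) (t : ℕ) :
    Run G c.1 c.2 (trace G c t) ((step G)^[t] c).1 ((step G)^[t] c).2 := by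
  induction t with
  | zero => exact Run.refl _ _
  | succ t ih =>
    rw [Function.iterate_succ_apply', trace]
    exact ih.trans (run_step _)

theorem Run.exists_trace_eq {p p' : P} {s s' : List Γ} {w : List β} (h : Run G p s w p' s') :
    ∃ t, trace G (p, s) t = w := by
  induction h with
  | refl p s => exact ⟨0, rfl⟩
  | @head p p' p'' z v r s'' w w' hG hr ih =>
    obtain ⟨t, ht⟩ := ih
    refine ⟨1 + t, ?_⟩
    rw [trace_add]
    simp [trace, step, emit, hG, ht]

theorem step_append (p : P) {x : List Γ} (hx : x ≠ []) (s : List Γ) :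
    step G (p, x ++ s) = ((step G (p, x)).1, (step G (p, x)).2 ++ s) ∧
      emit G (p, x ++ s) = emit G (p, x) := by
  obtain ⟨z, r, rfl⟩ := List.exists_cons_of_ne_nil hx
  simp only [List.cons_append, step, emit]
  cases G p z <;> simp

theorem iterate_append {c : P × List Γ} (s : List Γ) {t : ℕ}
    (h : ∀ j < t, ((step G)^[j] c).2 ≠ []) :
    (step G)^[t] (c.1, c.2 ++ s) = (((step G)^[t] c).1, ((step G)^[t] c).2 ++ s) ∧
      trace G (c.1, c.2 ++ s) t = trace G c t := by
  induction t with
  | zero => simp [trace]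
  | succ t ih =>
    obtain ⟨h₁, h₂⟩ := ih fun j hj => h j (by omega)
    obtain ⟨h₃, h₄⟩ := step_append (G := G) ((step G)^[t] c).1 (h t (by omega)) s
    simp only [Function.iterate_succ_apply', trace, h₁, h₂, h₃, h₄, and_self]

/-- A sequence of stack configurations emitting `b` infinitely often is eventually periodic, up
to pushing a fixed word `u` below the active part of the stack in each period. -/
theorem exists_period [Finite P] [Finite Γ] [BEq β] (G : TopRewriting P Γ β)
    (c : P × List Γ) (b : β) (hunb : ∀ n, ∃ t, n < (trace G c t).count b) :
    ∃ (t₁ π : ℕ) (y : List β) (u s : List Γ), 0 < y.count b ∧ ∀ j, ∃ q x w, ∀ k,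
      (step G)^[t₁ + k * π + j] c = (q, x ++ (List.replicate k u).flatten ++ s) ∧
      trace G c (t₁ + k * π + j) = trace G c t₁ ++ (List.replicate k y).flatten ++ w := by
  have hmono : Monotone fun t => (trace G c t).count b :=
    monotone_nat_of_le_succ fun t => by simp [trace]
  have hne : ∀ t, ((step G)^[t] c).2 ≠ [] := by
    intro t ht
    obtain ⟨t', ht'⟩ := hunb ((trace G c t).count b)
    have hfix : ∀ d, (step G)^[d] ((step G)^[t] c) = (step G)^[t] c ∧
        trace G ((step G)^[t] c) d = [] := by
      generalize (step G)^[t] c = e at ht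
      obtain ⟨p, s⟩ := e
      obtain rfl : s = [] := ht
      intro d
      induction d with
      | zero => simp [trace]
      | succ d ih => simp [Function.iterate_succ_apply', trace, ih, step, emit]
    have hle : (trace G c t').count b ≤ (trace G c (t + t')).count b := hmono (by omega)
    rw [trace_add, (hfix t').2, List.append_nil] at hle
    omega
  let M : Set ℕ := {t | ∀ t', t ≤ t' → ((step G)^[t] c).2.length ≤ ((step G)^[t'] c).2.length}
  have hM : M.Infinite := by
    rw [Set.infinite_iff_exists_gt]
    intro T
    let f : {t // T < t} → ℕ := fun t => ((step G)^[t.1] c).2.length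
    have : Nonempty {t // T < t} := ⟨⟨T + 1, by omega⟩⟩
    refine ⟨(Function.argmin f).1, fun t' ht' => ?_, (Function.argmin f).2⟩
    exact Function.argmin_le f ⟨t', lt_of_lt_of_le (Function.argmin f).2 ht'⟩
  obtain ⟨t₁, ht₁, t₂, ht₂, hlt, heq⟩ := hM.exists_lt_map_eq_of_mapsTo
    (f := fun t => (((step G)^[t] c).1, ((step G)^[t] c).2.head?)) (t := Set.univ)
    (fun _ _ => Set.mem_univ _) Set.finite_univ
  obtain ⟨π, rfl⟩ := Nat.exists_eq_add_of_le hlt.le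
  obtain ⟨z, s, hzs⟩ := List.exists_cons_of_ne_nil (hne t₁)
  set q := ((step G)^[t₁] c).1 with hq
  have hc : (step G)^[t₁] c = (q, [z] ++ s) := Prod.ext hq hzs
  have hkeep : ∀ j, ((step G)^[j] (q, [z])).2 ≠ [] := by
    intro j
    induction j using Nat.strong_induction_on with
    | _ j ih =>
      intro hj
      have h₁ := (iterate_append (c := (q, [z])) s ih).1
      have h₂ := ht₁ (t₁ + j) (by omega)
      rw [add_comm, Function.iterate_add_apply, hc] at h₂
      simp only at h₁
      rw [h₁, hj] at h₂
      simp at h₂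
  have hloc : ∀ r j, (step G)^[j] (q, [z] ++ r) =
      (((step G)^[j] (q, [z])).1, ((step G)^[j] (q, [z])).2 ++ r) ∧
      trace G (q, [z] ++ r) j = trace G (q, [z]) j := fun r j =>
    iterate_append (c := (q, [z])) r fun i _ => hkeep i
  obtain ⟨u, hu⟩ : ∃ u, (step G)^[π] (q, [z]) = (q, [z] ++ u) := by
    obtain ⟨a, u, hau⟩ := List.exists_cons_of_ne_nil (hkeep π)
    simp only [Prod.mk.injEq] at heq
    rw [add_comm, Function.iterate_add_apply, hc, (hloc s π).1, hau] at heq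
    refine ⟨u, Prod.ext heq.1.symm ?_⟩
    simp at heq
    rw [hau, heq.2]
    rfl
  have hper : ∀ k, (step G)^[k * π] (q, [z]) = (q, [z] ++ (List.replicate k u).flatten) ∧
      trace G (q, [z]) (k * π) = (List.replicate k (trace G (q, [z]) π)).flatten := by
    intro k
    induction k with
    | zero => simp [trace]
    | succ k ih =>
      rw [Nat.succ_mul, trace_add, add_comm (k * π) π, Function.iterate_add_apply, ih.1, ih.2,
        (hloc _ π).1, (hloc _ π).2, hu]
      constructor
      · simp [List.replicate_succ]
      · simp [List.replicate_succ']
  have hmain : ∀ j k, (step G)^[t₁ + k * π + j] c = (((step G)^[j] (q, [z])).1,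
        ((step G)^[j] (q, [z])).2 ++ (List.replicate k u).flatten ++ s) ∧
      trace G c (t₁ + k * π + j) = trace G c t₁ ++
        (List.replicate k (trace G (q, [z]) π)).flatten ++ trace G (q, [z]) j := by
    intro j k
    have h₁ : (step G)^[t₁ + k * π] c = (q, [z] ++ ((List.replicate k u).flatten ++ s)) := by
      rw [add_comm, Function.iterate_add_apply, hc, (hloc s _).1, (hper k).1]
      simp
    constructor
    · rw [add_comm, Function.iterate_add_apply, h₁, (hloc _ j).1]
      simp
    · rw [trace_add, h₁, (hloc _ j).2, trace_add, hc, (hloc s _).2, (hper k).2]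
  refine ⟨t₁, π, trace G (q, [z]) π, u, s, ?_, fun j => ⟨_, _, _, hmain j⟩⟩
  rw [Nat.pos_iff_ne_zero]
  intro h0
  obtain ⟨t, ht⟩ := hunb ((trace G c t₁).count b)
  have h₁ := (hmain 0 t).2
  have h₂ : (trace G c t).count b ≤ (trace G c (t₁ + t * π + 0)).count b :=
    hmono (by nlinarith [show 0 < π by omega])
  rw [h₁] at h₂
  simp [List.count_flatten, h0, trace] at h₂
  omega

end TopRewriting

namespace PDT

open TopRewriting

variable {A Γ Q : Type*}

theorem Step.unique {In Out : Type*} {M : PDT In Out Γ Q} {a b c : ID In Out Γ Q}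
    (h : Step M a b) (h' : Step M a c) : b = c := by
  cases h with
  | @lam q z s inp out q' v h =>
    cases h' with
    | lam h' =>
      rw [h] at h'
      cases h'
      rfl
    | read h' => rcases M.det q z with hd | hd <;> simp_all
  | @read q z s b inp out q' v h =>
    cases h' with
    | lam h' => rcases M.det q z with hd | hd <;> simp_all
    | read h' =>
      rw [h] at h'
      cases h'
      rfl

theorem Terminal.not_step {In Out : Type*} {M : PDT In Out Γ Q} {a b : ID In Out Γ Q}
    (h : Terminal M a) : ¬ Step M a b := by
  intro hs
  cases hs with
  | lam h' => simp [h.2 _ _ rfl] at h'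
  | read h' => simp [Terminal] at h

theorem Terminal.reflTransGen {In Out : Type*} {M : PDT In Out Γ Q} {a b c : ID In Out Γ Q}
    (h : Relation.ReflTransGen (Step M) a b) (hb : Terminal M b)
    (h' : Relation.ReflTransGen (Step M) a c) : Relation.ReflTransGen (Step M) c b := by
  rcases Relation.ReflTransGen.total_of_right_unique (r := Step M)
    (fun _ _ _ h h' => Step.unique h h') h h'
    with hbc | hcb
  · rcases hbc.cases_head with rfl | ⟨d, hd, -⟩
    · exact .refl
    · exact (hb.not_step hd).elim
  · exact hcb

/-- The behaviour of a pushdown transducer on `aaa…`; each emitted `none` marks the reading of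
one input symbol, the other emitted symbols are the output. -/
def unarySystem (M : PDT (Option A) A Γ Q) (a : A) : TopRewriting Q Γ (Option A) := fun q z =>
  match M.δ q none z with
  | some (q', v) => some (q', v, (M.ν q none z).map some)
  | none =>
    match M.δ q (some (some a)) z with
    | some (q', v) => some (q', v, none :: (M.ν q (some (some a)) z).map some)
    | none => none

/-- The behaviour of a pushdown transducer on the endmarker; the additional component of the
state is `true` as long as the endmarker has not been read. -/
def endSystem (M : PDT (Option A) A Γ Q) : TopRewriting (Q × Bool) Γ A := fun p z =>
  match M.δ p.1 none z with
  | some (q', v) => some ((q', p.2), v, M.ν p.1 none z)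
  | none =>
    if p.2 then
      match M.δ p.1 (some none) z with
      | some (q', v) => some ((q', false), v, M.ν p.1 (some none) z)
      | none => none
    else none

theorem count_none_map_some [DecidableEq A] (l : List A) : (l.map some).count none = 0 := by
  simp [List.count_eq_zero]

theorem reduceOption_map_some (l : List A) : (l.map some).reduceOption = l := by
  simp [List.reduceOption, List.filterMap_map]

theorem reflTransGen_of_run_unarySystem [DecidableEq A] {M : PDT (Option A) A Γ Q} {a : A}
    {q q' : Q} {s s' : List Γ} {w : List (Option A)} (h : Run (M.unarySystem a) q s w q' s')
    (inp : List (Option A)) (o : List A) :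
    Relation.ReflTransGen (Step M) (q, s, List.replicate (w.count none) (some a) ++ inp, o)
      (q', s', inp, o ++ w.reduceOption) := by
  induction h generalizing o with
  | refl q s => simpa using Relation.ReflTransGen.refl
  | @head q q' q'' z v s s'' w w' hG _ ih =>
    unfold unarySystem at hG
    split at hG
    · rename_i q₁ v₁ hδ
      simp only [Option.some.injEq, Prod.mk.injEq] at hG
      obtain ⟨rfl, rfl, rfl⟩ := hG
      refine Relation.ReflTransGen.head (Step.lam hδ) ?_
      simpa [List.count_append, count_none_map_some, List.reduceOption_append,
        reduceOption_map_some] using ih (o ++ M.ν q none z)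
    · split at hG
      · rename_i q₁ v₁ hδ
        simp only [Option.some.injEq, Prod.mk.injEq] at hG
        obtain ⟨rfl, rfl, rfl⟩ := hG
        have hc : (none :: (M.ν q (some (some a)) z).map some ++ w').count none =
            w'.count none + 1 := by
          simp [count_none_map_some]
        rw [hc, List.replicate_succ, List.cons_append]
        refine Relation.ReflTransGen.head (Step.read hδ) ?_
        simpa [List.reduceOption_append, reduceOption_map_some] using
          ih (o ++ M.ν q (some (some a)) z)
      · cases hG

theorem exists_run_unarySystem [DecidableEq A] {M : PDT (Option A) A Γ Q} {a : A}
    {c d : ID (Option A) A Γ Q} (h : Relation.ReflTransGen (Step M) c d) (hd : d.2.2.1 = [])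
    (m : ℕ) (hc : c.2.2.1 = List.replicate m (some a) ++ [none]) :
    ∃ w q' s', Run (M.unarySystem a) c.1 c.2.1 w q' s' ∧ w.count none = m := by
  induction h using Relation.ReflTransGen.head_induction_on generalizing m with
  | refl => simp [hd] at hc
  | head hs _ ih =>
    cases hs with
    | @lam q z s inp out q' v hδ =>
      obtain ⟨w, q₂, s₂, hr, hw⟩ := ih m hc
      refine ⟨_, q₂, s₂, Run.head (w := (M.ν q none z).map some) ?_ hr, ?_⟩
      · simp [unarySystem, hδ]
      · simp [count_none_map_some, hw]
    | @read q z s b inp out q' v hδ =>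
      cases m with
      | zero => exact ⟨[], _, _, Run.refl _ _, rfl⟩
      | succ m =>
        simp only [List.replicate_succ, List.cons_append, List.cons.injEq] at hc
        obtain ⟨rfl, hc⟩ := hc
        obtain ⟨w, q₂, s₂, hr, hw⟩ := ih m hc
        have hl : M.δ q none z = none := by
          rcases M.det q z with hd | hd
          · exact hd
          · simp [hd] at hδ
        refine ⟨_, q₂, s₂, Run.head (w := none :: (M.ν q (some (some a)) z).map some) ?_ hr, ?_⟩
        · simp [unarySystem, hδ, hl]
        · simp [count_none_map_some, hw]

theorem count_emit_unarySystem_le [DecidableEq A] (M : PDT (Option A) A Γ Q) (a : A)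
    (c : Q × List Γ) : (emit (M.unarySystem a) c).count none ≤ 1 := by
  obtain ⟨q, _ | ⟨z, s⟩⟩ := c
  · simp [emit]
  · simp only [emit, unarySystem]
    cases M.δ q none z with
    | some p => simp [count_none_map_some]
    | none => cases M.δ q (some (some a)) z <;> simp [count_none_map_some]

theorem halts_endSystem {M : PDT (Option A) A Γ Q} {c d : ID (Option A) A Γ Q}
    (h : Relation.ReflTransGen (Step M) c d) (hd : Terminal M d) (b : Bool)
    (hc : c.2.2.1 = if b then [none] else []) :
    ∃ w, d.2.2.2 = c.2.2.2 ++ w ∧ Halts M.endSystem (c.1, b) c.2.1 w (d.1, false) := by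
  induction h using Relation.ReflTransGen.head_induction_on generalizing b with
  | refl =>
    obtain ⟨q, s, inp, o⟩ := d
    obtain ⟨rfl, hd⟩ := hd
    cases b with
    | true => simp at hc
    | false =>
      refine ⟨[], by simp, s, Run.refl _ _, fun z r hzr => ?_⟩
      simp [endSystem, hd z r hzr]
  | head hs _ ih =>
    cases hs with
    | @lam q z s inp out q' v hδ =>
      obtain ⟨w, hw, s₂, hr, hst⟩ := ih b hc
      refine ⟨M.ν q none z ++ w, by simpa using hw, s₂, Run.head ?_ hr, hst⟩
      simp [endSystem, hδ]
    | @read q z s x inp out q' v hδ =>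
      cases b with
      | false => simp at hc
      | true =>
        obtain ⟨rfl, rfl⟩ : x = none ∧ inp = [] := by simpa using hc
        have hl : M.δ q none z = none := by
          rcases M.det q z with hd | hd
          · exact hd
          · simp [hd] at hδ
        obtain ⟨w, hw, s₂, hr, hst⟩ := ih false rfl
        refine ⟨M.ν q (some none) z ++ w, by simpa using hw, s₂, Run.head ?_ hr, hst⟩
        simp [endSystem, hδ, hl]

end PDT

namespace PDCE

open TopRewriting PDT

variable {A Γ Q : Type*}

theorem computes (C : PDCE A Γ Q) (w : List A) :
    C.Computes (endmark w) (C.finalState w) (C.output w) :=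
  (C.total w).choose_spec.choose_spec

/-- The output on a unary word, split at any time at which the whole word has been read. -/
theorem output_replicate [DecidableEq A] (C : PDCE A Γ Q) (a : A) (t : ℕ) {n : ℕ} {q : Q}
    {s : List Γ} {w : List (Option A)}
    (hc : (step (C.unarySystem a))^[t] (C.q₀, [C.z₀]) = (q, s))
    (hw : trace (C.unarySystem a) (C.q₀, [C.z₀]) t = w) (hn : w.count none = n) :
    ∃ w', C.output (List.replicate n a) = w.reduceOption ++ w' ∧
      Halts C.endSystem (q, true) s w' (C.finalState (List.replicate n a), false) := by
  have hr := run_iterate (G := C.unarySystem a) (C.q₀, [C.z₀]) t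
  rw [hc, hw] at hr
  have h₁ := reflTransGen_of_run_unarySystem hr [none] []
  obtain ⟨s', h₂, hT⟩ := C.computes (List.replicate n a)
  rw [endmark, List.map_replicate, ← hn] at h₂
  have h₃ := Terminal.reflTransGen h₂ (by rwa [hn]) h₁
  rw [hn] at h₃
  simpa using halts_endSystem h₃ hT true rfl

theorem exists_lt_count_trace [DecidableEq A] (C : PDCE A Γ Q) (a : A) (n : ℕ) :
    ∃ t, n < (trace (C.unarySystem a) (C.q₀, [C.z₀]) t).count none := by
  obtain ⟨s', h, hT⟩ := C.computes (List.replicate (n + 1) a)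
  obtain ⟨w, q', s, hr, hw⟩ := exists_run_unarySystem (a := a) h rfl (n + 1) (by simp [endmark])
  obtain ⟨t, ht⟩ := hr.exists_trace_eq
  exact ⟨t, by rw [ht, hw]; omega⟩

/-- The output of an information-lossless pushdown compressor on the powers of a letter grows
at least linearly, and at most linearly along an arithmetic progression. -/
theorem IL.linear_output_replicate [Fintype Γ] [Fintype Q] {C : PDCE A Γ Q} (hIL : C.IL) (a : A) :
    ∃ n₀ D B R : ℕ, 0 < D ∧ 0 < R ∧
      (∀ n, n₀ ≤ n → (n - n₀) / D ≤ (C.output (List.replicate n a)).length) ∧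
      ∀ k, (C.output (List.replicate (n₀ + k * R) a)).length ≤ B * (k + 1) := by
  classical
  set G := C.unarySystem a
  set c : Q × List Γ := (C.q₀, [C.z₀])
  obtain ⟨t₁, π, y, u, s, hy, hper⟩ := exists_period G c none (C.exists_lt_count_trace a)
  set n₀ := (trace G c t₁).count none
  obtain ⟨R, hR⟩ : ∃ R, R = y.count none := ⟨_, rfl⟩
  rw [← hR] at hy
  have hQ : 0 < Fintype.card (Q × Bool) := Fintype.card_pos_iff.2 ⟨(C.q₀, true)⟩
  have key : ∀ n, n₀ ≤ n → (∀ k, k / Fintype.card (Q × Bool) ≤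
      (C.output (List.replicate (n + k * R) a)).length) ∧
      ∃ B, ∀ k, (C.output (List.replicate (n + k * R) a)).length ≤ B * (k + 1) := by
    intro n hn
    obtain ⟨j, hj⟩ : ∃ j, (trace G c (t₁ + j)).count none = n := by
      have hex : ∃ j, n ≤ (trace G c (t₁ + j)).count none := by
        obtain ⟨t, ht⟩ := C.exists_lt_count_trace a n
        refine ⟨t, ht.le.trans ?_⟩
        rw [add_comm, trace_add, List.count_append]
        exact Nat.le_add_right _ _
      refine ⟨Nat.find hex, le_antisymm ?_ (Nat.find_spec hex)⟩
      rcases hf : Nat.find hex with _ | j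
      · exact hn
      · have h₁ := Nat.find_min hex (m := j) (by omega)
        have h₂ : (emit G ((step G)^[t₁ + j] c)).count none ≤ 1 :=
          count_emit_unarySystem_le C.toPDT a _
        rw [← add_assoc, trace, List.count_append]
        omega
    obtain ⟨q, x, w, hqx⟩ := hper j
    have hw : n₀ + w.count none = n := by
      have := (hqx 0).2
      simp only [zero_mul, add_zero, List.replicate_zero, List.flatten_nil, List.append_nil] at this
      rw [← hj, this, List.count_append]
    have hsplit := fun k => C.output_replicate a _ (hqx k).1 (hqx k).2 (n := n + k * R) (by
      rw [List.count_append, List.count_append, List.count_flatten]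
      simp
      lia)
    choose W hW hH using hsplit
    have hlen : ∀ k, (C.output (List.replicate (n + k * R) a)).length =
        (trace G c t₁).reduceOption.length + k * y.reduceOption.length +
          w.reduceOption.length + (W k).length := by
      intro k
      have hflat : ((List.replicate k y).flatten.reduceOption).length =
          k * y.reduceOption.length := by
        induction k with
        | zero => simp [List.reduceOption]
        | succ k ih =>
          rw [List.replicate_succ, List.flatten_cons, List.reduceOption_append,
            List.length_append, ih]
          ring
      rw [hW, List.reduceOption_append, List.reduceOption_append, List.length_append,
        List.length_append, List.length_append, hflat]
    constructor
    · intro k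
      rcases Nat.eq_zero_or_pos y.reduceOption.length with hy0 | hy0
      · have hy0' : ∀ k, (List.replicate k y).flatten.reduceOption = [] := by
          intro k
          induction k with
          | zero => simp [List.reduceOption]
          | succ k ih =>
            rw [List.replicate_succ, List.flatten_cons, List.reduceOption_append, ih,
              List.length_eq_zero_iff.1 hy0]
            rfl
        have := div_card_le_length hH (fun k k' hkk => by
          simp only [Prod.mk.injEq, and_true] at hkk
          have := congrArg List.length (hIL (a₁ := List.replicate (n + k * R) a)
            (a₂ := List.replicate (n + k' * R) a) (by
              simp only [hW, List.reduceOption_append, hy0', hkk]))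
          simp only [List.length_replicate] at this
          exact Nat.eq_of_mul_eq_mul_right hy (by omega)) k
        rw [hlen]
        omega
      · have h₁ : k / Fintype.card (Q × Bool) ≤ k := Nat.div_le_self _ _
        have h₂ : k ≤ k * y.reduceOption.length := Nat.le_mul_of_pos_right _ hy0
        rw [hlen]
        omega
    · obtain ⟨B, hB⟩ := exists_length_le_linear hH
      refine ⟨(trace G c t₁).reduceOption.length + y.reduceOption.length +
        w.reduceOption.length + B, fun k => ?_⟩
      have := hB k
      rw [hlen]
      nlinarith [Nat.zero_le (k * (trace G c t₁).reduceOption.length),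
        Nat.zero_le (k * w.reduceOption.length)]
  obtain ⟨B, hB⟩ := (key n₀ le_rfl).2
  refine ⟨n₀, R * Fintype.card (Q × Bool), B, R, Nat.mul_pos hy hQ, hy, fun n hn => ?_, hB⟩
  have h := (key (n₀ + (n - n₀) % R) (by omega)).1 ((n - n₀) / R)
  rw [add_assoc, Nat.mod_add_div'] at h
  rwa [← Nat.div_div_eq_div_mul, show n = n₀ + (n - n₀) by omega, Nat.add_sub_cancel_left]

end PDCE

namespace FSC

/-- The compressor encoding every block `0ᵐ⁺¹` as `0`, and every block `0ⁱ1` with `i ≤ m` as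
`1ⁱ⁺¹0`. -/
def zeroBlock (m : ℕ) : FSC Bool (Fin (m + 1)) where
  δ i b := if b = false ∧ i.val < m then i + 1 else 0
  ν i b := if b then List.replicate (i + 1) true ++ [false] else if i.val < m then [] else [false]
  q₀ := 0

/-- A decoder for `zeroBlock m`, with a counter for the symbols `1` of the current code word. -/
def zeroBlockDecode (m : ℕ) : ℕ → List Bool → List Bool
  | _, [] => []
  | j, true :: l => zeroBlockDecode m (j + 1) l
  | 0, false :: l => List.replicate (m + 1) false ++ zeroBlockDecode m 0 l
  | j + 1, false :: l => List.replicate j false ++ true :: zeroBlockDecode m 0 l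

theorem zeroBlockDecode_replicate (m i j : ℕ) (l : List Bool) :
    zeroBlockDecode m j (List.replicate i true ++ l) = zeroBlockDecode m (j + i) l := by
  induction i generalizing j with
  | zero => rfl
  | succ i ih =>
    rw [List.replicate_succ, List.cons_append, zeroBlockDecode, ih]
    congr 1
    omega

theorem val_zeroBlock_δ_false (m : ℕ) (i : Fin (m + 1)) :
    ((zeroBlock m).δ i false).val = if i.val < m then i.val + 1 else 0 := by
  unfold zeroBlock
  split_ifs with h
  · simp [h, Fin.val_add_one_of_lt (i := i) (Fin.lt_def.2 h)]
  · simp [h]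

theorem zeroBlockDecode_outAux (m : ℕ) (w : List Bool) (i : Fin (m + 1)) :
    zeroBlockDecode m 0 ((zeroBlock m).outAux i w) ++
      List.replicate (w.foldl (zeroBlock m).δ i).val false = List.replicate i.val false ++ w := by
  induction w generalizing i with
  | nil => simp [outAux, zeroBlockDecode]
  | cons b w ih =>
    rw [outAux, List.foldl_cons]
    cases b with
    | true =>
      have hδ : (zeroBlock m).δ i true = 0 := by simp [zeroBlock]
      have hν : (zeroBlock m).ν i true = List.replicate (i + 1) true ++ [false] := by
        simp [zeroBlock]
      have := ih 0
      rw [hδ, hν, List.append_assoc, zeroBlockDecode_replicate, zero_add, List.singleton_append,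
        zeroBlockDecode, List.append_assoc, List.cons_append, this]
      simp
    | false =>
      have hδ := val_zeroBlock_δ_false m i
      have := ih ((zeroBlock m).δ i false)
      by_cases hi : i.val < m
      · have hν : (zeroBlock m).ν i false = [] := by simp [zeroBlock, hi]
        rw [if_pos hi] at hδ
        rw [hν, List.nil_append, this, hδ, List.replicate_succ', List.append_assoc]
        rfl
      · have hν : (zeroBlock m).ν i false = [false] := by simp [zeroBlock, hi]
        rw [if_neg hi] at hδ
        rw [hν, List.singleton_append, zeroBlockDecode, List.append_assoc, this, hδ,
          show i.val = m by omega, List.replicate_succ']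
        simp

theorem zeroBlock_IL (m : ℕ) : (zeroBlock m).IL := by
  intro w w' h
  obtain ⟨h₁, h₂⟩ : (zeroBlock m).output w = (zeroBlock m).output w' ∧
    (zeroBlock m).finalState w = (zeroBlock m).finalState w' := Prod.mk.inj h
  have hw := zeroBlockDecode_outAux m w 0
  have hw' := zeroBlockDecode_outAux m w' 0
  unfold output at h₁
  unfold finalState at h₂
  rw [show (zeroBlock m).q₀ = 0 from rfl] at h₁ h₂
  rw [h₁, h₂] at hw
  simpa using hw.symm.trans hw'

theorem length_zeroBlock_outAux (m n : ℕ) (i : Fin (m + 1)) :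
    (m + 1) * ((zeroBlock m).outAux i (List.replicate n false)).length ≤ n + i := by
  induction n generalizing i with
  | zero => simp [outAux]
  | succ n ih =>
    have h := ih ((zeroBlock m).δ i false)
    rw [val_zeroBlock_δ_false] at h
    rw [List.replicate_succ, outAux, List.length_append, mul_add]
    by_cases hi : i.val < m
    · have hν : (zeroBlock m).ν i false = [] := by simp [zeroBlock, hi]
      rw [if_pos hi] at h
      simp only [hν, List.length_nil]
      omega
    · have hν : (zeroBlock m).ν i false = [false] := by simp [zeroBlock, hi]
      rw [if_neg hi] at h
      simp only [hν, List.length_singleton]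
      omega

end FSC

open Filter in
theorem limsup_zeroBlock_le (m : ℕ) :
    limsup (fun n : ℕ => (((FSC.zeroBlock m).output (List.replicate n false)).length : ℝ) / n)
      atTop ≤ 1 / (m + 1) := by
  refine limsup_le_of_le (isCoboundedUnder_le_of_le atTop (x := 0) fun n => by positivity) ?_
  filter_upwards [eventually_gt_atTop 0] with n hn
  have h : (m + 1) * ((FSC.zeroBlock m).output (List.replicate n false)).length ≤ n := by
    exact FSC.length_zeroBlock_outAux m n 0
  have hr : ((m : ℝ) + 1) * ((FSC.zeroBlock m).output (List.replicate n false)).length ≤ n := by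
    exact_mod_cast h
  rw [div_le_div_iff₀ (by exact_mod_cast hn) (by positivity)]
  linarith

open Filter in
/-- A sequence growing at least linearly, and at most linearly along an arithmetic progression,
has positive lower growth rate. -/
theorem le_liminf_div {f : ℕ → ℕ} {n₀ D B R : ℕ} (hD : 0 < D) (hR : 0 < R)
    (hlow : ∀ n, n₀ ≤ n → (n - n₀) / D ≤ f n) (hup : ∀ k, f (n₀ + k * R) ≤ B * (k + 1)) :
    1 / (2 * D : ℝ) ≤ liminf (fun n : ℕ => (f n : ℝ) / n) atTop := by
  refine le_liminf_of_le ?_ ?_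
  · refine IsCoboundedUnder.of_frequently_le (a := 2 * (B : ℝ)) ?_
    rw [frequently_atTop]
    intro N
    refine ⟨n₀ + (N + 1) * R, by nlinarith, ?_⟩
    have h₁ := hup (N + 1)
    have h₂ : N + 1 ≤ n₀ + (N + 1) * R := by nlinarith
    rw [div_le_iff₀ (by positivity)]
    have h₃ : f (n₀ + (N + 1) * R) ≤ 2 * B * (n₀ + (N + 1) * R) := by nlinarith
    exact_mod_cast h₃
  · filter_upwards [eventually_ge_atTop (2 * (n₀ + D))] with n hn
    have h₁ := hlow n (by omega)
    have h₂ := Nat.lt_div_mul_add (a := n - n₀) hD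
    have h₃ : n ≤ f n * (2 * D) := by
      have : (n - n₀) / D * D ≤ f n * D := Nat.mul_le_mul_right _ h₁
      rw [mul_comm 2 D, ← mul_assoc]
      omega
    have hn0 : 0 < n := by omega
    rw [div_le_div_iff₀ (by positivity) (by exact_mod_cast hn0), one_mul]
    exact_mod_cast h₃

/-- No pushdown compressor is universal for finite-state
compressors: for every information-lossless pushdown compressor `C` over the
binary alphabet working with an endmarker, there exist an information-lossless
finite-state compressor `C'` and an infinite binary sequence `S` (namely
`S = 0^∞`) such that `R_{C'}(S) < ρ_C(S)`. -/
theorem pd_not_universal_for_fs {Γ Q : Type} [Fintype Γ] [Fintype Q]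
    (C : PDCE Bool Γ Q) (hIL : C.IL) :
    ∃ (Q' : Type) (_ : Fintype Q') (C' : FSC Bool Q') (S : ℕ → Bool),
      C'.IL ∧ S = (fun _ => false) ∧
      Filter.limsup
          (fun n : ℕ => ((C'.output ((List.range n).map S)).length : ℝ) / n)
          Filter.atTop <
        Filter.liminf
          (fun n : ℕ => ((C.output ((List.range n).map S)).length : ℝ) / n)
          Filter.atTop := by
  obtain ⟨n₀, D, B, R, hD, hR, hlow, hup⟩ := hIL.linear_output_replicate false
  have hlist : ∀ n, (List.range n).map (fun _ : ℕ => false) = List.replicate n false := by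
    simp
  refine ⟨_, inferInstance, FSC.zeroBlock (2 * D), fun _ => false, FSC.zeroBlock_IL _, rfl, ?_⟩
  simp only [hlist]
  refine (limsup_zeroBlock_le _).trans_lt (lt_of_lt_of_le ?_ (le_liminf_div hD hR hlow hup))
  rw [Nat.cast_mul, Nat.cast_ofNat]
  gcongr
  exact lt_add_one _
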